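/- arXiv:2604.23780 — 4 statements merged into one kernel-verified Lean document; each statement's English description precedes it below -/
import Mathlib

section
/- Let n be a positive integer, let c > 0 be a real number, and let v ∈ ℝⁿ. Then the vector m₀ := (2 / (1 + √(1 + 4c‖v‖))) • v is the unique vector m ∈ ℝⁿ satisfying m + c‖m‖ • m = v. In particular, for every c > 0 the map m ↦ m + c‖m‖ • m is a bijection of ℝⁿ. -/
theorem add_norm_smul_self_eq_iff {E : Type*} [NormedAddCommGroup E] [NormedSpace ℝ E]
    {c : ℝ} (hc : 0 ≤ c) (m v : E) :
    m + (c * ‖m‖) • m = v ↔ m = (2 / (1 + Real.sqrt (1 + 4 * c * ‖v‖))) • v := by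
  constructor
  · rintro rfl
    have hr : 0 ≤ c * ‖m‖ := by positivity
    have hm : m + (c * ‖m‖) • m = (1 + c * ‖m‖) • m := by rw [add_smul, one_smul]
    have hsqrt : Real.sqrt (1 + 4 * c * ‖(1 + c * ‖m‖) • m‖) = 1 + 2 * (c * ‖m‖) := by
      rw [norm_smul, Real.norm_of_nonneg (by positivity),
        show 1 + 4 * c * ((1 + c * ‖m‖) * ‖m‖) = (1 + 2 * (c * ‖m‖)) ^ 2 by ring,
        Real.sqrt_sq (by positivity)]
    have hscalar : 2 / (1 + (1 + 2 * (c * ‖m‖))) * (1 + c * ‖m‖) = 1 := by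
      rw [div_mul_eq_mul_div, div_eq_one_iff_eq (by positivity)]
      ring
    rw [hm, hsqrt, smul_smul, hscalar, one_smul]
  · rintro rfl
    set s := Real.sqrt (1 + 4 * c * ‖v‖) with hs
    have hs0 : 0 ≤ s := Real.sqrt_nonneg _
    have hs2 : s ^ 2 = 1 + 4 * c * ‖v‖ := Real.sq_sqrt (by positivity)
    have hscalar : 2 / (1 + s) + c * (2 / (1 + s) * ‖v‖) * (2 / (1 + s)) = 1 := by
      have h : 1 + s ≠ 0 := by positivity
      field_simp
      linear_combination -hs2
    rw [norm_smul, Real.norm_of_nonneg (by positivity), smul_smul, ← add_smul, hscalar, one_smul]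


/-- Unique solvability of the implicit Manning-friction momentum update
`m + c‖m‖ • m = v` in Euclidean space, with explicit solution
`m₀ = (2 / (1 + √(1 + 4c‖v‖))) • v`, and bijectivity of the map. -/
theorem manning_update_unique_solution (n : ℕ) (hn : 0 < n) (c : ℝ) (hc : 0 < c)
    (v : EuclideanSpace ℝ (Fin n)) :
    (∀ m : EuclideanSpace ℝ (Fin n),
        m + (c * ‖m‖) • m = v ↔
          m = (2 / (1 + Real.sqrt (1 + 4 * c * ‖v‖))) • v) ∧
    Function.Bijective (fun m : EuclideanSpace ℝ (Fin n) => m + (c * ‖m‖) • m) := by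
  refine ⟨fun m => add_norm_smul_self_eq_iff hc.le m v, fun a b hab => ?_, fun w => ?_⟩
  · exact ((add_norm_smul_self_eq_iff hc.le a _).1 hab).trans
      ((add_norm_smul_self_eq_iff hc.le b _).1 rfl).symm
  · exact ⟨_, (add_norm_smul_self_eq_iff hc.le _ w).2 rfl⟩
end

section
/- Let n be a positive integer, let ε, τ, g, k, h > 0 and η ∈ ℝ be real numbers, and let m⋆, w ∈ ℝⁿ. Set v_ε := ε² • m⋆ − (τ g h) • w. Then m₀ := (2 / (ε² + √(ε⁴ + (4 τ g k² / h^η) ‖v_ε‖))) • v_ε is the unique vector m ∈ ℝⁿ satisfying m + (τ g k² / (ε² h^η)) ‖m‖ • m = m⋆ − (τ g h / ε²) • w. -/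
/-- The equation `(a + c ‖m‖) • m = v` with `a > 0` and `c ≥ 0` has exactly one solution, obtained
from the positive root of a scalar quadratic. -/
theorem add_mul_norm_smul_eq_iff {E : Type*} [NormedAddCommGroup E] [NormedSpace ℝ E]
    {a c : ℝ} (ha : 0 < a) (hc : 0 ≤ c) (m v : E) :
    (a + c * ‖m‖) • m = v ↔ m = (2 / (a + Real.sqrt (a ^ 2 + 4 * c * ‖v‖))) • v := by
  constructor
  · rintro rfl
    have hpos : 0 < a + c * ‖m‖ := by positivity
    have hsqrt : Real.sqrt (a ^ 2 + 4 * c * ‖(a + c * ‖m‖) • m‖) = a + 2 * c * ‖m‖ := by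
      rw [norm_smul, Real.norm_of_nonneg hpos.le, Real.sqrt_eq_iff_mul_self_eq (by positivity)
        (by positivity)]
      ring
    have hone : 2 / (a + (a + 2 * c * ‖m‖)) * (a + c * ‖m‖) = 1 := by
      rw [show a + (a + 2 * c * ‖m‖) = 2 * (a + c * ‖m‖) by ring]
      field_simp
    rw [hsqrt, smul_smul, hone, one_smul]
  · intro hm
    have hsq := Real.sq_sqrt (show 0 ≤ a ^ 2 + 4 * c * ‖v‖ by positivity)
    have hs := Real.sqrt_nonneg (a ^ 2 + 4 * c * ‖v‖)
    generalize Real.sqrt (a ^ 2 + 4 * c * ‖v‖) = s at hm hsq hs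
    have hone : (a + c * (2 / (a + s) * ‖v‖)) * (2 / (a + s)) = 1 := by
      have hpos : 0 < a + s := by positivity
      field_simp
      linear_combination -hsq
    have hnorm : ‖m‖ = 2 / (a + s) * ‖v‖ := by
      rw [hm, norm_smul, Real.norm_of_nonneg (by positivity)]
    rw [hnorm, hm, smul_smul, hone, one_smul]


/-- Closed-form solution of the implicit momentum stage of the first-order
semi-implicit IMEX scheme: with `v_ε = ε² • m⋆ − (τ g h) • w`, the unique
solution of `m + (τ g k²/(ε² h^η)) ‖m‖ • m = m⋆ − (τ g h/ε²) • w` is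
`m₀ = (2 / (ε² + √(ε⁴ + (4 τ g k²/h^η) ‖v_ε‖))) • v_ε`. -/
theorem si_imex_momentum_stage_unique_solution (n : ℕ) (hn : 0 < n)
    (ε τ g k h η : ℝ) (hε : 0 < ε) (hτ : 0 < τ) (hg : 0 < g) (hk : 0 < k) (hh : 0 < h)
    (mstar w : EuclideanSpace ℝ (Fin n)) :
    ∀ m : EuclideanSpace ℝ (Fin n),
      m + (τ * g * k ^ 2 / (ε ^ 2 * h ^ η) * ‖m‖) • m
          = mstar - (τ * g * h / ε ^ 2) • w ↔
        m = (2 / (ε ^ 2 + Real.sqrt (ε ^ 4 +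
              4 * τ * g * k ^ 2 / h ^ η * ‖ε ^ 2 • mstar - (τ * g * h) • w‖))) •
            (ε ^ 2 • mstar - (τ * g * h) • w) := by
  intro m
  have hε2 : ε ^ 2 ≠ 0 := by positivity
  have hη : 0 < h ^ η := Real.rpow_pos_of_pos hh η
  have hc : 0 ≤ τ * g * k ^ 2 / h ^ η := by positivity
  have hsol := add_mul_norm_smul_eq_iff (pow_pos hε 2) hc m
    (ε ^ 2 • mstar - (τ * g * h) • w)
  rw [show (ε ^ 2) ^ 2 = ε ^ 4 by ring, show 4 * (τ * g * k ^ 2 / h ^ η)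
    = 4 * τ * g * k ^ 2 / h ^ η by ring] at hsol
  rw [← hsol, ← smul_right_inj hε2, smul_add, smul_sub, smul_smul, smul_smul, ← add_smul]
  congr! 3
  · field_simp
  · field_simp
end

section
/- Let n be a positive integer, let ε, τ, g, k, h > 0 and η ∈ ℝ be real numbers, and let m⋆, w ∈ ℝⁿ. Set v_ε := ε² • m⋆ − (τ g h) • w, and let m be the unique vector in ℝⁿ satisfying m + (τ g k² / (ε² h^η)) ‖m‖ • m = m⋆ − (τ g h / ε²) • w. Then ‖m‖ = (−ε² + √(ε⁴ + (4 τ g k² / h^η) ‖v_ε‖)) / (2 τ g k² / h^η). -/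
/-- Explicit formula for the norm of the implicitly updated momentum in the
first-order semi-implicit scheme: if `m` solves
`m + (τ g k²/(ε² h^η)) ‖m‖ • m = m⋆ − (τ g h/ε²) • w`, then with
`v_ε = ε² • m⋆ − (τ g h) • w` one has
`‖m‖ = (−ε² + √(ε⁴ + (4 τ g k²/h^η) ‖v_ε‖)) / (2 τ g k²/h^η)`. -/
theorem si_imex_momentum_stage_norm (n : ℕ) (hn : 0 < n)
    (ε τ g k h η : ℝ) (hε : 0 < ε) (hτ : 0 < τ) (hg : 0 < g) (hk : 0 < k) (hh : 0 < h)
    (mstar w : EuclideanSpace ℝ (Fin n))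
    (m : EuclideanSpace ℝ (Fin n))
    (hm : m + (τ * g * k ^ 2 / (ε ^ 2 * h ^ η) * ‖m‖) • m
          = mstar - (τ * g * h / ε ^ 2) • w) :
    ‖m‖ = (-ε ^ 2 + Real.sqrt (ε ^ 4 +
            4 * τ * g * k ^ 2 / h ^ η * ‖ε ^ 2 • mstar - (τ * g * h) • w‖)) /
          (2 * τ * g * k ^ 2 / h ^ η) := by
  have hH : 0 < h ^ η := Real.rpow_pos_of_pos hh η
  obtain ⟨a, ha⟩ : ∃ a, a = τ * g * k ^ 2 / h ^ η := ⟨_, rfl⟩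
  have ha_pos : 0 < a := by rw [ha]; positivity
  have hv : ε ^ 2 • mstar - (τ * g * h) • w = (ε ^ 2 + a * ‖m‖) • m := by
    have hw : ε ^ 2 * (τ * g * h / ε ^ 2) = τ * g * h := by field_simp
    have hc : ε ^ 2 * (τ * g * k ^ 2 / (ε ^ 2 * h ^ η) * ‖m‖) = a * ‖m‖ := by
      rw [ha]; field_simp
    have hscaled := congrArg (fun x => ε ^ 2 • x) hm
    simp only [smul_add, smul_sub, smul_smul, hw, hc] at hscaled
    rw [← hscaled, add_smul]
  have hnorm : ‖ε ^ 2 • mstar - (τ * g * h) • w‖ = (ε ^ 2 + a * ‖m‖) * ‖m‖ := by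
    rw [hv, norm_smul, Real.norm_of_nonneg (by positivity)]
  have h4 : 4 * τ * g * k ^ 2 / h ^ η = 4 * a := by rw [ha]; ring
  have h2 : 2 * τ * g * k ^ 2 / h ^ η = 2 * a := by rw [ha]; ring
  have hsq : ε ^ 4 + 4 * a * ((ε ^ 2 + a * ‖m‖) * ‖m‖) = (ε ^ 2 + 2 * a * ‖m‖) ^ 2 := by
    ring
  rw [hnorm, h4, h2, hsq, Real.sqrt_sq (by positivity), eq_div_iff (by positivity)]
  ring
end

section
/- Let n be a positive integer, let τ, g, k, h > 0 and η ∈ ℝ be real numbers, let m⋆ ∈ ℝⁿ, and let v ∈ ℝⁿ with v ≠ 0. Then, as ε → 0⁺, the vector (2 / (ε² + √(ε⁴ + (4 τ g k² / h^η) ‖ε² • m⋆ − (τ g h) • v‖))) • (ε² • m⋆ − (τ g h) • v) tends to −√(h^{η+1}/k²) · ‖v‖^{-1/2} • v. -/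
/-- The scalar identity identifying the value at `ε = 0` of the momentum update, where `r` plays the
role of the norm of the gradient. -/
theorem limit_momentum_coefficient {τ g k h r : ℝ} (η : ℝ) (hτ : 0 < τ) (hg : 0 < g) (hk : 0 < k)
    (hh : 0 < h) (hr : 0 < r) :
    2 / Real.sqrt (4 * τ * g * k ^ 2 / h ^ η * (τ * g * h * r)) * (τ * g * h) =
      Real.sqrt (h ^ (η + 1) / k ^ 2) * r ^ (-(1 : ℝ) / 2) := by
  have hη : 0 < h ^ η := Real.rpow_pos_of_pos hh η
  have hpow : r ^ (-(1 : ℝ) / 2) = (Real.sqrt r)⁻¹ := by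
    rw [Real.sqrt_eq_rpow, ← Real.rpow_neg hr.le, neg_div]
  rw [hpow, Real.rpow_add_one hh.ne']
  have hs : 0 < Real.sqrt (h ^ η * h / k ^ 2) := Real.sqrt_pos.2 (by positivity)
  have hs2 : Real.sqrt (h ^ η * h / k ^ 2) ^ 2 = h ^ η * h / k ^ 2 := Real.sq_sqrt (by positivity)
  have hr0 : 0 < Real.sqrt r := Real.sqrt_pos.2 hr
  have hden : Real.sqrt (4 * τ * g * k ^ 2 / h ^ η * (τ * g * h * r)) =
      2 * τ * g * h * Real.sqrt r / Real.sqrt (h ^ η * h / k ^ 2) := by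
    rw [Real.sqrt_eq_iff_mul_self_eq_of_pos (by positivity), ← sq, div_pow, hs2, mul_pow,
      Real.sq_sqrt hr.le]
    field_simp
    ring
  rw [hden]
  field_simp

/-- Asymptotic-preserving limit of the implicitly updated momentum: as
`ε → 0⁺`, the vector
`(2 / (ε² + √(ε⁴ + (4 τ g k²/h^η) ‖ε² • m⋆ − (τ g h) • v‖))) • (ε² • m⋆ − (τ g h) • v)`
tends to `−√(h^{η+1}/k²) ‖v‖^{-1/2} • v` for `v ≠ 0`. -/
theorem si_imex_momentum_limit (n : ℕ) (hn : 0 < n)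
    (τ g k h η : ℝ) (hτ : 0 < τ) (hg : 0 < g) (hk : 0 < k) (hh : 0 < h)
    (mstar v : EuclideanSpace ℝ (Fin n)) (hv : v ≠ 0) :
    Filter.Tendsto
      (fun ε : ℝ =>
        (2 / (ε ^ 2 + Real.sqrt (ε ^ 4 +
            4 * τ * g * k ^ 2 / h ^ η * ‖ε ^ 2 • mstar - (τ * g * h) • v‖))) •
          (ε ^ 2 • mstar - (τ * g * h) • v))
      (nhdsWithin 0 (Set.Ioi 0))
      (nhds ((-Real.sqrt (h ^ (η + 1) / k ^ 2) * ‖v‖ ^ (-(1 : ℝ) / 2)) • v)) := by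
  have hv' : 0 < ‖v‖ := norm_pos_iff.2 hv
  have hη : 0 < h ^ η := Real.rpow_pos_of_pos hh η
  have hc : 0 < τ * g * h := by positivity
  have hnorm : ‖(0 : ℝ) ^ 2 • mstar - (τ * g * h) • v‖ = τ * g * h * ‖v‖ := by
    rw [zero_pow two_ne_zero, zero_smul, zero_sub, norm_neg, norm_smul, Real.norm_of_nonneg hc.le]
  have hden : (0 : ℝ) ^ 2 + Real.sqrt ((0 : ℝ) ^ 4 +
      4 * τ * g * k ^ 2 / h ^ η * ‖(0 : ℝ) ^ 2 • mstar - (τ * g * h) • v‖) ≠ 0 := by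
    rw [hnorm]
    positivity
  have hcont : ContinuousAt (fun ε : ℝ =>
      (2 / (ε ^ 2 + Real.sqrt (ε ^ 4 +
          4 * τ * g * k ^ 2 / h ^ η * ‖ε ^ 2 • mstar - (τ * g * h) • v‖))) •
        (ε ^ 2 • mstar - (τ * g * h) • v)) 0 := by
    fun_prop (disch := exact hden)
  convert hcont.tendsto.mono_left nhdsWithin_le_nhds using 2
  rw [hnorm, neg_mul, ← limit_momentum_coefficient η hτ hg hk hh hv']
  simp [smul_smul]
end
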